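/- Let (X_t) be a continuous-time birth-and-death chain on {1,…,2n−1} whose transition rates are symmetric under the reflection x ↦ 2n − x (i.e., r(x, x+1) = r(2n−x, 2n−x−1) for all x). Then there exists an eigenfunction f of the generator corresponding to the spectral gap eigenvalue satisfying f(x) = −f(2n−x) for all x ∈ {1,…,2n−1}. -/

import Mathlib

open Finset

/-- `f` is a (nonzero) eigenfunction of the generator of the birth-and-death chain on
`{1, …, 2n-1}` with up-rates `p` and down-rates `q`, for the eigenvalue `μ` of `-L`. -/
def IsEigenBD (n : ℕ) (p q : ℕ → ℝ) (μ : ℝ) (f : ℕ → ℝ) : Prop :=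
  (∃ x ∈ Finset.Icc 1 (2 * n - 1), f x ≠ 0) ∧
  ∀ x ∈ Finset.Icc 1 (2 * n - 1),
    p x * (f (x + 1) - f x) + q x * (f (x - 1) - f x) = -μ * f x

/-- The shooting solution started from `1` at the left end. -/
noncomputable def shootBD (p q : ℕ → ℝ) (μ : ℝ) : ℕ → ℝ
  | 0 => 1
  | 1 => 1
  | (x + 2) => shootBD p q μ (x + 1) +
      (-μ * shootBD p q μ (x + 1) - q (x + 1) * (shootBD p q μ x - shootBD p q μ (x + 1))) /
        p (x + 1)

lemma shootBD_continuous (p q : ℕ → ℝ) (x : ℕ) :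
    Continuous (fun μ => shootBD p q μ x) ∧ Continuous (fun μ => shootBD p q μ (x + 1)) := by
  induction x with
  | zero => simp only [shootBD]; exact ⟨continuous_const, continuous_const⟩
  | succ x ih =>
    obtain ⟨h1, h2⟩ := ih
    refine ⟨h2, ?_⟩
    simp only [shootBD]
    fun_prop

lemma shootBD_zero (p q : ℕ → ℝ) (x : ℕ) :
    shootBD p q 0 x = 1 ∧ shootBD p q 0 (x + 1) = 1 := by
  induction x with
  | zero => simp [shootBD]
  | succ x ih =>
    obtain ⟨h1, h2⟩ := ih
    refine ⟨h2, ?_⟩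
    simp only [shootBD, h1, h2]
    simp

lemma shootBD_eq (p q : ℕ → ℝ) (μ : ℝ) (x : ℕ) (hx : 1 ≤ x) (hp : p x ≠ 0) :
    p x * (shootBD p q μ (x + 1) - shootBD p q μ x)
      + q x * (shootBD p q μ (x - 1) - shootBD p q μ x) = -μ * shootBD p q μ x := by
  obtain ⟨y, rfl⟩ : ∃ y, x = y + 1 := ⟨x - 1, by omega⟩
  simp only [shootBD, Nat.add_sub_cancel]
  field_simp
  ring

/-- Any solution of the eigenvalue equation is a multiple of the shooting solution. -/
lemma shootBD_unique (n : ℕ) (p q : ℕ → ℝ)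
    (hp : ∀ x ∈ Finset.Icc 1 (2 * n - 2), 0 < p x) (hqb : q 1 = 0) (μ : ℝ) (g : ℕ → ℝ)
    (hg : ∀ x ∈ Finset.Icc 1 (2 * n - 1),
      p x * (g (x + 1) - g x) + q x * (g (x - 1) - g x) = -μ * g x) (x : ℕ)
    (hx1 : 1 ≤ x) (hx : x ≤ 2 * n - 1) : g x = g 1 * shootBD p q μ x := by
  induction x using Nat.strong_induction_on with
  | _ x ih =>
    by_cases h1 : x = 1
    · subst h1; simp [shootBD]
    obtain ⟨y, rfl⟩ : ∃ y, x = y + 1 := ⟨x - 1, by omega⟩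
    have hpy := hp y (Finset.mem_Icc.2 ⟨by omega, by omega⟩)
    have e1 := hg y (Finset.mem_Icc.2 ⟨by omega, by omega⟩)
    have e2 := shootBD_eq p q μ y (by omega) hpy.ne'
    have i1 := ih y (by omega) (by omega) (by omega)
    have i2 : q y * g (y - 1) = q y * (g 1 * shootBD p q μ (y - 1)) := by
      by_cases hy : y = 1
      · subst hy; simp [hqb]
      · rw [ih (y - 1) (by omega) (by omega) (by omega)]
    apply mul_left_cancel₀ hpy.ne'
    rw [i1] at e1
    linear_combination e1 - g 1 * e2 - i2

/-- A shooting solution nonnegative on `1..n` has no zeros before `n`. -/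
lemma shootBD_pos (n : ℕ) (p q : ℕ → ℝ)
    (hp : ∀ x ∈ Finset.Icc 1 (2 * n - 2), 0 < p x)
    (hq : ∀ x ∈ Finset.Icc 2 (2 * n - 1), 0 < q x) (μ : ℝ)
    (h0 : ∀ k, 1 ≤ k → k ≤ n → 0 ≤ shootBD p q μ k) (k : ℕ) (hk1 : 1 ≤ k) (hkn : k < n) :
    0 < shootBD p q μ k := by
  induction k, hk1 using Nat.le_induction with
  | base => simp [shootBD]
  | succ k hk ih =>
    have ih := ih (by omega)
    refine lt_of_le_of_ne (h0 _ (by omega) (by omega)) fun h => ?_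
    have hpk := hp (k + 1) (Finset.mem_Icc.2 ⟨by omega, by omega⟩)
    have hqk := hq (k + 1) (Finset.mem_Icc.2 ⟨by omega, by omega⟩)
    have e := shootBD_eq p q μ (k + 1) (by omega) hpk.ne'
    rw [← h, Nat.add_sub_cancel] at e
    have := mul_nonneg hpk.le (h0 (k + 1 + 1) (by omega) (by omega))
    have := mul_pos hqk ih
    linarith

/-- Monotonicity of the shooting solution while it is positive (positive eigenvalue). -/
lemma shootBD_anti (n : ℕ) (p q : ℕ → ℝ)
    (hp : ∀ x ∈ Finset.Icc 1 (2 * n - 2), 0 < p x)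
    (hq : ∀ x ∈ Finset.Icc 2 (2 * n - 1), 0 < q x) (hqb : q 1 = 0) (μ : ℝ) (hμ : 0 < μ)
    (hn : 2 ≤ n)
    (h0 : ∀ k, 1 ≤ k → k ≤ n → 0 < shootBD p q μ k) (k : ℕ) (hk1 : 1 ≤ k) (hkn : k ≤ n) :
    shootBD p q μ (k + 1) < shootBD p q μ k := by
  induction k, hk1 using Nat.le_induction with
  | base =>
    have hpk := hp 1 (Finset.mem_Icc.2 ⟨by omega, by omega⟩)
    have e := shootBD_eq p q μ 1 le_rfl hpk.ne'
    rw [hqb] at e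
    have := mul_pos hμ (h0 1 (by omega) (by omega))
    by_contra hc
    have := mul_nonneg hpk.le (sub_nonneg.2 (not_lt.1 hc))
    linarith
  | succ k hk ih =>
    have ih := ih (by omega)
    have hpk := hp (k + 1) (Finset.mem_Icc.2 ⟨by omega, by omega⟩)
    have hqk := hq (k + 1) (Finset.mem_Icc.2 ⟨by omega, by omega⟩)
    have e := shootBD_eq p q μ (k + 1) (by omega) hpk.ne'
    rw [Nat.add_sub_cancel] at e
    have := mul_pos hμ (h0 (k + 1) (by omega) (by omega))
    have := mul_pos hqk (sub_pos.2 ih)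
    by_contra hc
    have := mul_nonneg hpk.le (sub_nonneg.2 (not_lt.1 hc))
    linarith

/-- For a negative eigenvalue the shooting solution is positive and increasing. -/
lemma shootBD_mono (n : ℕ) (p q : ℕ → ℝ)
    (hp : ∀ x ∈ Finset.Icc 1 (2 * n - 2), 0 < p x)
    (hq : ∀ x ∈ Finset.Icc 2 (2 * n - 1), 0 < q x) (hqb : q 1 = 0) (μ : ℝ) (hμ : μ < 0)
    (hn : 2 ≤ n) (k : ℕ) (hk1 : 1 ≤ k) (hkn : k ≤ n) :
    0 < shootBD p q μ k ∧ shootBD p q μ k < shootBD p q μ (k + 1) := by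
  induction k, hk1 using Nat.le_induction with
  | base =>
    have hpk := hp 1 (Finset.mem_Icc.2 ⟨by omega, by omega⟩)
    have e := shootBD_eq p q μ 1 le_rfl hpk.ne'
    have h1 : 0 < shootBD p q μ 1 := by simp [shootBD]
    refine ⟨h1, ?_⟩
    rw [hqb] at e
    have := mul_pos (neg_pos.2 hμ) h1
    by_contra hc
    have := mul_nonneg hpk.le (sub_nonneg.2 (not_lt.1 hc))
    linarith
  | succ k hk ih =>
    obtain ⟨ih0, ih⟩ := ih (by omega)
    have hpk := hp (k + 1) (Finset.mem_Icc.2 ⟨by omega, by omega⟩)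
    have hqk := hq (k + 1) (Finset.mem_Icc.2 ⟨by omega, by omega⟩)
    have e := shootBD_eq p q μ (k + 1) (by omega) hpk.ne'
    rw [Nat.add_sub_cancel] at e
    have h1 := ih0.trans ih
    refine ⟨h1, ?_⟩
    have := mul_pos (neg_pos.2 hμ) h1
    have := mul_pos hqk (sub_pos.2 ih)
    by_contra hc
    have := mul_nonneg hpk.le (sub_nonneg.2 (not_lt.1 hc))
    linarith

/-- Reflection of the rates. -/
lemma rates_reflect (n : ℕ) (p q : ℕ → ℝ)
    (hpb : p (2 * n - 1) = 0) (hqb : q 1 = 0)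
    (hsym : ∀ x ∈ Finset.Icc 1 (2 * n - 2), p x = q (2 * n - x)) (x : ℕ) (hx1 : 1 ≤ x)
    (hx : x ≤ 2 * n - 1) : p x = q (2 * n - x) ∧ q x = p (2 * n - x) := by
  constructor
  · by_cases h : x = 2 * n - 1
    · rw [show 2 * n - x = 1 by omega, h, hpb, hqb]
    · exact hsym x (Finset.mem_Icc.2 ⟨hx1, by omega⟩)
  · by_cases h : x = 1
    · rw [h, hpb, hqb]
    · rw [hsym (2 * n - x) (Finset.mem_Icc.2 ⟨by omega, by omega⟩)]
      congr 1; omega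

/-- If the shooting solution vanishes at `n`, its odd reflection is an eigenfunction. -/
lemma odd_reflection (n : ℕ) (hn : 2 ≤ n) (p q : ℕ → ℝ)
    (hp : ∀ x ∈ Finset.Icc 1 (2 * n - 2), 0 < p x)
    (hpb : p (2 * n - 1) = 0) (hqb : q 1 = 0)
    (hsym : ∀ x ∈ Finset.Icc 1 (2 * n - 2), p x = q (2 * n - x)) (μ : ℝ)
    (h0 : shootBD p q μ n = 0) :
    ∃ f : ℕ → ℝ, IsEigenBD n p q μ f ∧
      ∀ x ∈ Finset.Icc 1 (2 * n - 1), f x = - f (2 * n - x) := by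
  obtain ⟨f, hf⟩ : ∃ f : ℕ → ℝ, f = fun x => if x ≤ n then shootBD p q μ x
    else - shootBD p q μ (2 * n - x) := ⟨_, rfl⟩
  have hl : ∀ x, x ≤ n → f x = shootBD p q μ x := by
    intro x hx; simp [hf, hx]
  have hr : ∀ x, n ≤ x → f x = - shootBD p q μ (2 * n - x) := by
    intro x hx
    by_cases h : x = n
    · rw [hl x h.le, h, show 2 * n - n = n by omega, h0, neg_zero]
    · simp [hf, show ¬ x ≤ n by omega]
  refine ⟨f, ⟨⟨1, Finset.mem_Icc.2 ⟨by omega, by omega⟩, ?_⟩, ?_⟩, ?_⟩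
  · rw [hl 1 (by omega)]; simp [shootBD]
  · intro x hx
    obtain ⟨hx1, hx2⟩ := Finset.mem_Icc.1 hx
    obtain ⟨r1, r2⟩ := rates_reflect n p q hpb hqb hsym x hx1 hx2
    rcases lt_trichotomy x n with h | h | h
    · have := shootBD_eq p q μ x hx1 (hp x (Finset.mem_Icc.2 ⟨hx1, by omega⟩)).ne'
      rwa [hl x h.le, hl (x + 1) (by omega), hl (x - 1) (by omega)]
    · subst h
      rw [show 2 * x - x = x by omega] at r1
      rw [hl x le_rfl, hr (x + 1) (by omega), hl (x - 1) (by omega), h0, r1,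
        show 2 * x - (x + 1) = x - 1 by omega]
      ring
    · have := shootBD_eq p q μ (2 * n - x) (by omega)
        (hp (2 * n - x) (Finset.mem_Icc.2 ⟨by omega, by omega⟩)).ne'
      rw [hr x h.le, hr (x + 1) (by omega), hr (x - 1) (by omega), r1, r2,
        show 2 * n - (x + 1) = 2 * n - x - 1 by omega,
        show 2 * n - (x - 1) = 2 * n - x + 1 by omega]
      linear_combination -this
  · intro x hx
    obtain ⟨hx1, hx2⟩ := Finset.mem_Icc.1 hx
    rcases le_total x n with h | h
    · rw [hl x h, hr (2 * n - x) (by omega), show 2 * n - (2 * n - x) = x by omega, neg_neg]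
    · rw [hr x h, hl (2 * n - x) (by omega)]

/-- If positivity of the shooting solution fails somewhere in `[0, lam]`, then it vanishes at `n`
for some parameter in `(0, lam]`. -/
lemma exists_zero (n : ℕ) (p q : ℕ → ℝ)
    (hp : ∀ x ∈ Finset.Icc 1 (2 * n - 2), 0 < p x)
    (hq : ∀ x ∈ Finset.Icc 2 (2 * n - 1), 0 < q x) (lam : ℝ) (hlam : 0 < lam)
    (k : ℕ) (hk1 : 1 ≤ k) (hkn : k ≤ n) (hk : shootBD p q lam k ≤ 0) :
    ∃ μ, 0 < μ ∧ μ ≤ lam ∧ shootBD p q μ n = 0 := by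
  obtain ⟨S, hS⟩ : ∃ S : Set ℝ, S = Set.Icc 0 lam ∩
    ⋃ j ∈ Finset.Icc 1 n, {μ | shootBD p q μ j ≤ 0} := ⟨_, rfl⟩
  have hcl : IsCompact S := by
    rw [hS]
    refine isCompact_Icc.inter_right ?_
    refine Set.Finite.isClosed_biUnion (Finset.finite_toSet _) fun j _ => ?_
    exact isClosed_le (shootBD_continuous p q j).1 continuous_const
  have hmem : ∀ μ, μ ∈ S ↔ (0 ≤ μ ∧ μ ≤ lam) ∧ ∃ j, (1 ≤ j ∧ j ≤ n) ∧ shootBD p q μ j ≤ 0 := by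
    intro μ; rw [hS]; simp
  have hne : S.Nonempty := ⟨lam, (hmem _).2 ⟨⟨hlam.le, le_rfl⟩, k, ⟨hk1, hkn⟩, hk⟩⟩
  obtain ⟨m, hmS, hm⟩ := hcl.exists_isLeast hne
  obtain ⟨⟨hm0, hml⟩, j, ⟨hj1, hjn⟩, hj⟩ := (hmem m).1 hmS
  have hmpos : 0 < m := by
    refine lt_of_le_of_ne hm0 fun h => ?_
    rw [← h, (shootBD_zero p q j).1] at hj
    linarith
  have hnn : ∀ i, 1 ≤ i → i ≤ n → 0 ≤ shootBD p q m i := by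
    intro i hi1 hin
    by_contra hc
    have hc := not_le.1 hc
    -- intermediate value between 0 and m
    have hivt := intermediate_value_Icc' hm0 (shootBD_continuous p q i).1.continuousOn
    obtain ⟨t, ht, hti⟩ := hivt (show (0 : ℝ) ∈ _ from
      ⟨hc.le, by simp only [(shootBD_zero p q i).1]; norm_num⟩)
    have htm : m ≤ t := hm ((hmem t).2 ⟨⟨ht.1, ht.2.trans hml⟩, i, ⟨hi1, hin⟩, hti.le⟩)
    have : t = m := le_antisymm ht.2 htm
    subst this
    simp only at hti
    linarith
  refine ⟨m, hmpos, hml, ?_⟩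
  by_cases h : j = n
  · subst h; exact le_antisymm hj (hnn j hj1 le_rfl)
  · have := shootBD_pos n p q hp hq m hnn j hj1 (by omega)
    linarith

/-- A continuous-time birth-and-death chain on `{1, …, 2n-1}` whose rates are symmetric
under the reflection `x ↦ 2n - x` admits, for its spectral gap eigenvalue `lam`
(the smallest nonzero eigenvalue of `-L`), an eigenfunction `f` which is antisymmetric:
`f x = - f (2n - x)` for all `x ∈ {1, …, 2n-1}`. -/
theorem antisymmetric_gap_eigenfunction (n : ℕ) (hn : 1 ≤ n) (p q : ℕ → ℝ)
    (hp : ∀ x ∈ Finset.Icc 1 (2 * n - 2), 0 < p x)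
    (hq : ∀ x ∈ Finset.Icc 2 (2 * n - 1), 0 < q x)
    (hpb : p (2 * n - 1) = 0) (hqb : q 1 = 0)
    (hsym : ∀ x ∈ Finset.Icc 1 (2 * n - 2), p x = q (2 * n - x))
    (lam : ℝ) (hlam0 : lam ≠ 0)
    (hex : ∃ g : ℕ → ℝ, IsEigenBD n p q lam g)
    (hmin : ∀ (μ : ℝ) (f : ℕ → ℝ), IsEigenBD n p q μ f → μ ≠ 0 → lam ≤ μ) :
    ∃ f : ℕ → ℝ, IsEigenBD n p q lam f ∧
      ∀ x ∈ Finset.Icc 1 (2 * n - 1), f x = - f (2 * n - x) := by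
  obtain ⟨g, ⟨z, hz, hgz⟩, hg⟩ := hex
  obtain ⟨hz1, hz2⟩ := Finset.mem_Icc.1 hz
  -- the one-point chain has no nonzero eigenvalue
  by_cases hn2 : n = 1
  · exfalso
    subst hn2
    have h := hg 1 (by simp)
    have hz' : z = 1 := by omega
    subst hz'
    rw [hqb, show p 1 = 0 from hpb] at h
    simp only [zero_mul, add_zero] at h
    exact mul_ne_zero (neg_ne_zero.2 hlam0) hgz h.symm
  have hn2 : 2 ≤ n := by omega
  by_cases hpos : ∀ k, 1 ≤ k → k ≤ n → 0 < shootBD p q lam k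
  · refine ⟨fun x => g x - g (2 * n - x), ⟨?_, ?_⟩, ?_⟩
    · by_contra hc
      push Not at hc
      have huni := shootBD_unique n p q hp hqb lam g hg
      have hg1 : g 1 ≠ 0 := by
        intro h
        apply hgz
        rw [huni z hz1 hz2, h, zero_mul]
      have h := hc (n + 1) (Finset.mem_Icc.2 ⟨by omega, by omega⟩)
      rw [show 2 * n - (n + 1) = n - 1 by omega, huni (n + 1) (by omega) (by omega),
        huni (n - 1) (by omega) (by omega), ← mul_sub] at h
      have h := (mul_eq_zero.1 h).resolve_left hg1
      rcases lt_or_gt_of_ne hlam0 with hl | hl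
      · have h1 := (shootBD_mono n p q hp hq hqb lam hl hn2 n (by omega) le_rfl).2
        have h2 := (shootBD_mono n p q hp hq hqb lam hl hn2 (n - 1) (by omega) (by omega)).2
        rw [show n - 1 + 1 = n by omega] at h2
        linarith
      · have h1 := shootBD_anti n p q hp hq hqb lam hl hn2 hpos n (by omega) le_rfl
        have h2 := shootBD_anti n p q hp hq hqb lam hl hn2 hpos (n - 1) (by omega) (by omega)
        rw [show n - 1 + 1 = n by omega] at h2
        linarith
    · intro x hx
      obtain ⟨hx1, hx2⟩ := Finset.mem_Icc.1 hx
      obtain ⟨r1, r2⟩ := rates_reflect n p q hpb hqb hsym x hx1 hx2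
      have e1 := hg x hx
      have e2 := hg (2 * n - x) (Finset.mem_Icc.2 ⟨by omega, by omega⟩)
      rw [← r1, ← r2] at e2
      simp only
      rw [show 2 * n - (x + 1) = 2 * n - x - 1 by omega,
        show 2 * n - (x - 1) = 2 * n - x + 1 by omega]
      linear_combination e1 - e2
    · intro x hx
      obtain ⟨hx1, hx2⟩ := Finset.mem_Icc.1 hx
      simp only
      rw [show 2 * n - (2 * n - x) = x by omega]
      ring
  · push Not at hpos
    obtain ⟨k, hk1, hkn, hk⟩ := hpos
    have hl : 0 < lam := by
      by_contra hc
      have := (shootBD_mono n p q hp hq hqb lam (lt_of_le_of_ne (not_lt.1 hc) hlam0) hn2 k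
        hk1 hkn).1
      linarith
    obtain ⟨μ, hμ0, hμl, hμ⟩ := exists_zero n p q hp hq lam hl k hk1 hkn hk
    obtain ⟨f, hf, hfa⟩ := odd_reflection n hn2 p q hp hpb hqb hsym μ hμ
    have : lam = μ := le_antisymm (hmin μ f hf hμ0.ne') hμl
    rw [this]
    exact ⟨f, hf, hfa⟩
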